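/- arXiv:2511.20066 — 3 statements merged into one kernel-verified Lean document; each statement's English description precedes it below -/
import Mathlib

section
/- Let d be a positive integer, σ > 0, let V be a real symmetric positive definite d×d matrix, and let z_1, …, z_m ∈ ℝ^d. Then log det(V + σ^{-2} Σ_{k=1}^m z_k z_kᵀ) ≥ log det V + log(1 + σ^{-2} Σ_{k=1}^m z_kᵀ V^{-1} z_k). -/
open Matrix

/-- Expanding a product of factors `1 + f i` with `f i ≥ 0` dominates its first-order part. -/
theorem Finset.one_add_sum_le_prod_one_add_of_nonneg {ι : Type*} (s : Finset ι) {f : ι → ℝ}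
    (hf : ∀ i ∈ s, 0 ≤ f i) : 1 + ∑ i ∈ s, f i ≤ ∏ i ∈ s, (1 + f i) := by
  classical
  induction s using Finset.induction_on with
  | empty => simp
  | insert a s ha ih =>
    rw [Finset.sum_insert ha, Finset.prod_insert ha]
    have hs : ∀ i ∈ s, 0 ≤ f i := fun i hi => hf i (Finset.mem_insert_of_mem hi)
    have hfa : 0 ≤ f a := hf a (Finset.mem_insert_self a s)
    nlinarith [ih hs, mul_nonneg hfa (Finset.sum_nonneg hs)]

theorem Matrix.IsHermitian.det_one_add_eq_prod_eigenvalues {n : Type*} [Fintype n] [DecidableEq n]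
    {M : Matrix n n ℝ} (hM : M.IsHermitian) : (1 + M).det = ∏ i, (1 + hM.eigenvalues i) := by
  conv_lhs =>
    rw [hM.spectral_theorem, ← map_one (Unitary.conjStarAlgAut ℝ _ hM.eigenvectorUnitary),
      ← map_add, Unitary.conjStarAlgAut_apply, det_mul_right_comm]
  rw [Unitary.mul_star_self_of_mem hM.eigenvectorUnitary.2, one_mul, ← diagonal_one, diagonal_add,
    det_diagonal]
  rfl

theorem Matrix.PosSemidef.one_add_trace_le_det_one_add {n : Type*} [Fintype n] [DecidableEq n]
    {M : Matrix n n ℝ} (hM : M.PosSemidef) : 1 + M.trace ≤ (1 + M).det := by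
  rw [hM.isHermitian.det_one_add_eq_prod_eigenvalues, hM.isHermitian.trace_eq_sum_eigenvalues]
  exact Finset.one_add_sum_le_prod_one_add_of_nonneg _ fun i _ => hM.eigenvalues_nonneg i

open scoped MatrixOrder in
theorem Matrix.PosDef.det_mul_one_add_trace_le_det_add {n : Type*} [Fintype n] [DecidableEq n]
    {V W : Matrix n n ℝ} (hV : V.PosDef) (hW : W.PosSemidef) :
    V.det * (1 + (V⁻¹ * W).trace) ≤ (V + W).det := by
  obtain ⟨B, hB⟩ := CStarAlgebra.nonneg_iff_eq_star_mul_self.mp hV.inv.posSemidef.nonneg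
  have hM : (B * W * star B).PosSemidef := hW.mul_mul_conjTranspose_same B
  have hfactor : V + W = V * (1 + V⁻¹ * W) := by
    rw [mul_add, mul_one, mul_nonsing_inv_cancel_left _ _ hV.det_pos.ne'.isUnit]
  rw [hfactor, det_mul, hB, mul_assoc, det_one_add_mul_comm, trace_mul_comm]
  exact mul_le_mul_of_nonneg_left hM.one_add_trace_le_det_one_add hV.det_pos.le

/-- For a real symmetric positive definite `d × d` matrix `V`, `σ > 0`, and vectors
`z 1, …, z m ∈ ℝ^d`,
`log det (V + σ⁻² ∑ₖ zₖ zₖᵀ) ≥ log det V + log (1 + σ⁻² ∑ₖ zₖᵀ V⁻¹ zₖ)`. -/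
theorem log_det_add_outer_ge
    (d m : ℕ) (hd : 0 < d) (σ : ℝ) (hσ : 0 < σ)
    (V : Matrix (Fin d) (Fin d) ℝ) (hV : V.PosDef)
    (z : Fin m → (Fin d → ℝ)) :
    Real.log V.det
      + Real.log (1 + (σ ^ 2)⁻¹ * ∑ k, z k ⬝ᵥ (V⁻¹ *ᵥ z k))
    ≤ Real.log (V + (σ ^ 2)⁻¹ • ∑ k, vecMulVec (z k) (z k)).det := by
  have hs : 0 < (σ ^ 2)⁻¹ := by positivity
  have hW : ((σ ^ 2)⁻¹ • ∑ k, vecMulVec (z k) (z k)).PosSemidef :=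
    (posSemidef_sum _ fun k _ => posSemidef_vecMulVec_self_star (z k)).smul hs.le
  have htrace : (V⁻¹ * (σ ^ 2)⁻¹ • ∑ k, vecMulVec (z k) (z k)).trace
      = (σ ^ 2)⁻¹ * ∑ k, z k ⬝ᵥ (V⁻¹ *ᵥ z k) := by
    simp only [Matrix.mul_smul, trace_smul, smul_eq_mul, Matrix.mul_sum, trace_sum,
      mul_vecMulVec, trace_vecMulVec, dotProduct_comm]
  have hquad : 0 ≤ ∑ k, z k ⬝ᵥ (V⁻¹ *ᵥ z k) :=
    Finset.sum_nonneg fun k _ => hV.inv.posSemidef.dotProduct_mulVec_nonneg (z k)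
  have hpos : 0 < 1 + (σ ^ 2)⁻¹ * ∑ k, z k ⬝ᵥ (V⁻¹ *ᵥ z k) := by positivity
  rw [← Real.log_mul hV.det_pos.ne' hpos.ne', ← htrace]
  rw [← htrace] at hpos
  exact Real.log_le_log (mul_pos hV.det_pos hpos) (hV.det_mul_one_add_trace_le_det_add hW)
end

section
/- Let d_x, d_u be positive integers and let f, g : ℝ^{d_x} × ℝ^{d_u} → ℝ^{d_x}, π : ℝ^{d_x} → ℝ^{d_u}, r : ℝ^{d_x} × ℝ^{d_u} → ℝ, and ε : ℝ^{d_x} × ℝ^{d_u} → ℝ be functions such that: f is L_f-Lipschitz and r is L_r-Lipschitz, both with respect to the norm ‖(x,u)‖ = ‖x‖ + ‖u‖ on the product, π is L_π-Lipschitz, ‖f(z) - g(z)‖ ≤ ε(z) for all z ∈ ℝ^{d_x} × ℝ^{d_u}, and L̄ := L_f(1 + L_π) ≥ 1. Given any sequence of disturbance vectors (w_t)_{t≥0} in ℝ^{d_x} and a common initial state x_0 = x'_0 ∈ ℝ^{d_x}, define x_{t+1} = f(x_t, π(x_t)) + w_t and x'_{t+1} = g(x'_t, π(x'_t)) + w_t.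 Then for every horizon T ≥ 1, |Σ_{t=0}^{T-1} r(x_t, π(x_t)) - Σ_{t=0}^{T-1} r(x'_t, π(x'_t))| ≤ L_r (1 + L_π) · L̄^{T-1} · T · Σ_{t=0}^{T-1} ε(x'_t, π(x'_t)). -/
/-- Discrete Grönwall bound: a sequence started at zero with `d (t + 1) ≤ L * d t + e t` and
`1 ≤ L` satisfies `d t ≤ L ^ t * ∑ i < t, e i`. -/
theorem le_pow_mul_sum_of_le_mul_add {L : ℝ} (hL : 1 ≤ L) {d e : ℕ → ℝ} (he : ∀ t, 0 ≤ e t)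
    (hd0 : d 0 = 0) (hd : ∀ t, d (t + 1) ≤ L * d t + e t) (t : ℕ) :
    d t ≤ L ^ t * ∑ i ∈ Finset.range t, e i := by
  induction t with
  | zero => simp [hd0]
  | succ t ih =>
    calc d (t + 1) ≤ L * d t + e t := hd t
      _ ≤ L * (L ^ t * ∑ i ∈ Finset.range t, e i) + L ^ (t + 1) * e t := by
          gcongr
          exact le_mul_of_one_le_left (he t) (one_le_pow₀ hL)
      _ = L ^ (t + 1) * ∑ i ∈ Finset.range (t + 1), e i := by
          rw [Finset.sum_range_succ]; ring

/-- Pathwise value-difference bound: under the same Lipschitz/model-error assumptions as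
the error-propagation lemma, with `r` being `L_r`-Lipschitz w.r.t. the norm
`‖(x,u)‖ = ‖x‖ + ‖u‖`, the difference of cumulative rewards along the two trajectories
satisfies
`|∑_{t<T} r(x t, π (x t)) - ∑_{t<T} r(x' t, π (x' t))|
  ≤ L_r (1+L_π) L̄^(T-1) T ∑_{t<T} ε (x' t, π (x' t))` with `L̄ = L_f (1 + L_π)`. -/
theorem value_difference_pathwise
    (dx du : ℕ) (hdx : 0 < dx) (hdu : 0 < du)
    (Lf Lr Lπ : ℝ)
    (f g : EuclideanSpace ℝ (Fin dx) × EuclideanSpace ℝ (Fin du) → EuclideanSpace ℝ (Fin dx))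
    (π : EuclideanSpace ℝ (Fin dx) → EuclideanSpace ℝ (Fin du))
    (r : EuclideanSpace ℝ (Fin dx) × EuclideanSpace ℝ (Fin du) → ℝ)
    (ε : EuclideanSpace ℝ (Fin dx) × EuclideanSpace ℝ (Fin du) → ℝ)
    (hf : ∀ z z' : EuclideanSpace ℝ (Fin dx) × EuclideanSpace ℝ (Fin du),
      ‖f z - f z'‖ ≤ Lf * (‖z.1 - z'.1‖ + ‖z.2 - z'.2‖))
    (hr : ∀ z z' : EuclideanSpace ℝ (Fin dx) × EuclideanSpace ℝ (Fin du),
      |r z - r z'| ≤ Lr * (‖z.1 - z'.1‖ + ‖z.2 - z'.2‖))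
    (hπ : ∀ x x' : EuclideanSpace ℝ (Fin dx), ‖π x - π x'‖ ≤ Lπ * ‖x - x'‖)
    (hε : ∀ z, ‖f z - g z‖ ≤ ε z)
    (hL : 1 ≤ Lf * (1 + Lπ))
    (w : ℕ → EuclideanSpace ℝ (Fin dx))
    (x x' : ℕ → EuclideanSpace ℝ (Fin dx))
    (h0 : x 0 = x' 0)
    (hx : ∀ t, x (t + 1) = f (x t, π (x t)) + w t)
    (hx' : ∀ t, x' (t + 1) = g (x' t, π (x' t)) + w t) :
    ∀ T : ℕ, 1 ≤ T →
      |∑ t ∈ Finset.range T, r (x t, π (x t)) - ∑ t ∈ Finset.range T, r (x' t, π (x' t))|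
        ≤ Lr * (1 + Lπ) * (Lf * (1 + Lπ)) ^ (T - 1) * (T : ℝ) *
            ∑ t ∈ Finset.range T, ε (x' t, π (x' t)) := by
  obtain ⟨v, hv⟩ : ∃ v : EuclideanSpace ℝ (Fin dx), ‖v‖ = 1 :=
    ⟨EuclideanSpace.single ⟨0, hdx⟩ 1, by simp⟩
  have hLf : 0 ≤ Lf := by simpa [hv] using (norm_nonneg _).trans (hf (v, 0) (0, 0))
  have hLr : 0 ≤ Lr := by simpa [hv] using (abs_nonneg _).trans (hr (v, 0) (0, 0))
  have hLπ : 0 ≤ Lπ := by simpa [hv] using (norm_nonneg _).trans (hπ v 0)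
  have he : ∀ z, 0 ≤ ε z := fun z => (norm_nonneg _).trans (hε z)
  have hclosed : ∀ a b, ‖a - b‖ + ‖π a - π b‖ ≤ (1 + Lπ) * ‖a - b‖ := fun a b => by
    linarith [hπ a b]
  have hstep : ∀ t, ‖x (t + 1) - x' (t + 1)‖ ≤
      Lf * (1 + Lπ) * ‖x t - x' t‖ + ε (x' t, π (x' t)) := fun t => by
    rw [hx, hx', add_sub_add_right_eq_sub, mul_assoc]
    exact (norm_sub_le_norm_sub_add_norm_sub _ (f (x' t, π (x' t))) _).trans
      (add_le_add ((hf _ _).trans (mul_le_mul_of_nonneg_left (hclosed _ _) hLf)) (hε _))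
  have hdist := le_pow_mul_sum_of_le_mul_add (d := fun t => ‖x t - x' t‖) hL
    (fun t => he (x' t, π (x' t))) (by simp [h0]) hstep
  intro T _
  set S := ∑ t ∈ Finset.range T, ε (x' t, π (x' t))
  have hterm : ∀ t ∈ Finset.range T, |r (x t, π (x t)) - r (x' t, π (x' t))| ≤
      Lr * (1 + Lπ) * ((Lf * (1 + Lπ)) ^ (T - 1) * S) := fun t ht => by
    have htT : t < T := Finset.mem_range.mp ht
    have hsum : ∑ i ∈ Finset.range t, ε (x' i, π (x' i)) ≤ S :=
      Finset.sum_le_sum_of_subset_of_nonneg (Finset.range_subset_range.mpr htT.le)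
        fun _ _ _ => he _
    have hpow : (Lf * (1 + Lπ)) ^ t ≤ (Lf * (1 + Lπ)) ^ (T - 1) :=
      pow_le_pow_right₀ hL (by omega)
    calc |r (x t, π (x t)) - r (x' t, π (x' t))|
        ≤ Lr * ((1 + Lπ) * ‖x t - x' t‖) :=
          (hr _ _).trans (mul_le_mul_of_nonneg_left (hclosed _ _) hLr)
      _ = Lr * (1 + Lπ) * ‖x t - x' t‖ := by ring
      _ ≤ Lr * (1 + Lπ) * ((Lf * (1 + Lπ)) ^ (T - 1) * S) := by
          refine mul_le_mul_of_nonneg_left ((hdist t).trans ?_) (by positivity)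
          exact mul_le_mul hpow hsum (Finset.sum_nonneg fun _ _ => he _) (by positivity)
  rw [← Finset.sum_sub_distrib]
  refine (Finset.abs_sum_le_sum_abs _ _).trans ((Finset.sum_le_sum hterm).trans_eq ?_)
  rw [Finset.sum_const, Finset.card_range, nsmul_eq_mul]
  ring
end

section
/- Let Π be a nonempty type, let J, Ĵ, S, S' : Π → ℝ be functions with S(π) ≥ 0 and S'(π) ≥ 0 for all π ∈ Π, and let λ ≥ 0 be a real number. Assume: (i) |J(π) - Ĵ(π)| ≤ λ S(π) for all π ∈ Π; (ii) |J(π) - Ĵ(π)| ≤ λ S'(π) for all π ∈ Π; (iii) S(π) - S'(π) ≤ λ S'(π) for all π ∈ Π. Suppose π_n ∈ Π maximizes the objective Ĵ + λS, i.e., Ĵ(π) + λ S(π) ≤ Ĵ(π_n) + λ S(π_n) for all π ∈ Π. Then for every π* ∈ Π: (a) J(π*) ≤ Ĵ(π_n) + λ S(π_n); and (b) J(π*) - J(π_n) ≤ (2λ + λ²) · S'(π_n). -/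
/-- Abstract optimism and simple-regret lemma: if the true return `J` is `λ·S`- and
`λ·S'`-close to the surrogate return `Ĵ`, the uncertainty functionals satisfy
`S - S' ≤ λ S'`, and `π_n` maximizes the optimistic objective `Ĵ + λ S`, then
(a) `J π* ≤ Ĵ π_n + λ S π_n`, and (b) `J π* - J π_n ≤ (2λ + λ²) S' π_n`. -/
theorem optimism_and_simple_regret
    (P : Type*) [Nonempty P]
    (J Jhat S S' : P → ℝ) (lam : ℝ) (hlam : 0 ≤ lam)
    (hS : ∀ π : P, 0 ≤ S π) (hS' : ∀ π : P, 0 ≤ S' π)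
    (h1 : ∀ π : P, |J π - Jhat π| ≤ lam * S π)
    (h2 : ∀ π : P, |J π - Jhat π| ≤ lam * S' π)
    (h3 : ∀ π : P, S π - S' π ≤ lam * S' π)
    (πn : P) (hmax : ∀ π : P, Jhat π + lam * S π ≤ Jhat πn + lam * S πn) :
    ∀ πstar : P,
      J πstar ≤ Jhat πn + lam * S πn ∧
      J πstar - J πn ≤ (2 * lam + lam ^ 2) * S' πn := by
  intro πstar
  have optimism : J πstar ≤ Jhat πn + lam * S πn := by
    linarith [le_of_abs_le (h1 πstar), hmax πstar]
  refine ⟨optimism, ?_⟩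
  have model_error : Jhat πn - J πn ≤ lam * S' πn := by
    linarith [neg_le_of_abs_le (h2 πn)]
  have uncertainty : lam * (S πn - S' πn) ≤ lam * (lam * S' πn) :=
    mul_le_mul_of_nonneg_left (h3 πn) hlam
  linarith
end
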